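/- Let N ∈ ℕ be fixed. There exist M₀ > 0 and constants c, C > 0 such that for all φ ∈ (0,π) and all t > 0 satisfying (π−φ)/t ≥ M₀: c·W_t(φ)·(π−φ)^{-N}·t^{-N} ≤ ((−D)^N W_t)(φ) ≤ C·W_t(φ)·(π−φ)^{-N}·t^{-N}, where (−D)^N is applied to the function φ ↦ W_t(φ). -/

import Mathlib

/-- The one-dimensional Gauss-Weierstrass kernel `W_t(x) = (4*pi*t)^(-1/2) exp(-x^2/(4t))`. -/
noncomputable def W (t x : ℝ) : ℝ :=
  (1 / Real.sqrt (4 * Real.pi * t)) * Real.exp (-x ^ 2 / (4 * t))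

/-- The 2*pi-periodization of `W t` (heat kernel of the circle). -/
noncomputable def theta (t φ : ℝ) : ℝ := ∑' n : ℤ, W t (φ + 2 * Real.pi * n)

/-- The operator `f ↦ -(1/sin φ) * f'`. -/
noncomputable def negD (f : ℝ → ℝ) : ℝ → ℝ := fun φ => -(deriv f φ / Real.sin φ)

/-- Pair `(H_j, C_j)` with `H_j = (-D)^j (φ / (2 sin φ))` and `H_{j+1} = C_j / sin²`. -/
noncomputable def HC : ℕ → (ℝ → ℝ) × (ℝ → ℝ)
  | 0 => (fun φ => φ / (2 * Real.sin φ), fun φ => Real.cos φ * (φ / (2 * Real.sin φ)) - 1 / 2)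
  | (j + 1) => (fun φ => (HC j).2 φ / Real.sin φ ^ 2,
      fun φ => (2 * (j : ℝ) + 3) * Real.cos φ * ((HC j).2 φ / Real.sin φ ^ 2)
        + ((j : ℝ) + 1) ^ 2 * (HC j).1 φ)

theorem HC_fst_succ (j : ℕ) (φ : ℝ) : (HC (j + 1)).1 φ = (HC j).2 φ / Real.sin φ ^ 2 := rfl

theorem HC_snd_succ (j : ℕ) (φ : ℝ) : (HC (j + 1)).2 φ =
    (2 * (j : ℝ) + 3) * Real.cos φ * (HC (j + 1)).1 φ + ((j : ℝ) + 1) ^ 2 * (HC j).1 φ := rfl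

theorem HC_deriv (j : ℕ) : ∀ φ ∈ Set.Ioo 0 Real.pi,
    HasDerivAt (HC j).1 (-Real.sin φ * (HC (j + 1)).1 φ) φ ∧
    HasDerivAt (HC j).2 (-Real.sin φ * ((2 * (j : ℝ) + 1) * Real.cos φ * (HC (j + 1)).1 φ
      + ((j : ℝ) + 1) ^ 2 * (HC j).1 φ)) φ := by
  induction j with
  | zero =>
    intro φ hφ
    have hs : Real.sin φ ≠ 0 := (Real.sin_pos_of_mem_Ioo hφ).ne'
    have h1 : HasDerivAt (fun φ : ℝ => φ / (2 * Real.sin φ))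
        (-Real.sin φ * (HC (0 + 1)).1 φ) φ := by
      have := (hasDerivAt_id φ).div ((Real.hasDerivAt_sin φ).const_mul 2)
        (mul_ne_zero two_ne_zero hs)
      refine this.congr_deriv ?_
      simp only [HC, id]
      field_simp
      ring
    refine ⟨h1, ?_⟩
    have h2 := ((Real.hasDerivAt_cos φ).mul h1).sub_const (1 / 2)
    refine h2.congr_deriv ?_
    simp only [HC]
    push_cast
    ring
  | succ j ih =>
    intro φ hφ
    have hs : Real.sin φ ≠ 0 := (Real.sin_pos_of_mem_Ioo hφ).ne'
    obtain ⟨i1, i2⟩ := ih φ hφ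
    have h1 : HasDerivAt (HC (j + 1)).1 (-Real.sin φ * (HC (j + 1 + 1)).1 φ) φ := by
      have := i2.div ((Real.hasDerivAt_sin φ).pow 2) (pow_ne_zero 2 hs)
      refine this.congr_deriv ?_
      simp only [HC_fst_succ, HC_snd_succ]
      simp
      field_simp
      ring
    refine ⟨h1, ?_⟩
    have h2 := (((Real.hasDerivAt_cos φ).const_mul (2 * (j : ℝ) + 3)).mul h1).add
      (i1.const_mul (((j : ℝ) + 1) ^ 2))
    refine h2.congr_deriv ?_
    push_cast
    ring

theorem sin_ge_left {φ : ℝ} (h0 : 0 ≤ φ) (h1 : φ ≤ Real.pi / 2) :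
    2 / Real.pi * φ ≤ Real.sin φ := Real.mul_le_sin h0 h1

theorem sin_ge_right {φ : ℝ} (h0 : Real.pi / 2 ≤ φ) (h1 : φ ≤ Real.pi) :
    2 / Real.pi * (Real.pi - φ) ≤ Real.sin φ := by
  rw [← Real.sin_pi_sub]
  exact Real.mul_le_sin (by linarith) (by linarith)

theorem H0_bounds {φ : ℝ} (hφ : φ ∈ Set.Ioo 0 Real.pi) :
    Real.pi / 4 ≤ (HC 0).1 φ * (Real.pi - φ) ∧ (HC 0).1 φ * (Real.pi - φ) ≤ Real.pi ^ 2 / 4 := by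
  have hs := Real.sin_pos_of_mem_Ioo hφ
  obtain ⟨h0, h1⟩ := hφ
  have hp := Real.pi_pos
  have e : (HC 0).1 φ * (Real.pi - φ) = φ * (Real.pi - φ) / (2 * Real.sin φ) := by
    simp only [HC]; ring
  have s1 : Real.sin φ ≤ φ := Real.sin_le h0.le
  have s2 : Real.sin φ ≤ Real.pi - φ := by
    rw [← Real.sin_pi_sub]; exact Real.sin_le (by linarith)
  rw [e, le_div_iff₀ (by positivity), div_le_iff₀ (by positivity)]
  rcases le_total φ (Real.pi / 2) with h | h
  · have s3 := sin_ge_left h0.le h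
    rw [div_mul_eq_mul_div, div_le_iff₀ hp] at s3
    constructor <;> nlinarith
  · have s3 := sin_ge_right h h1.le
    rw [div_mul_eq_mul_div, div_le_iff₀ hp] at s3
    constructor <;> nlinarith

/-- Boundedness near zero: integrate `(sin^{2j+3} H_{j+1})' = -(j+1)² sin^{2j+2} H_j`. -/
theorem H_near_zero (j : ℕ) (K : ℝ) (hK : 0 ≤ K)
    (h : ∀ φ, 0 < φ → φ ≤ Real.pi / 2 → |(HC j).1 φ| ≤ K ∧ |(HC j).2 φ| ≤ K) :
    ∀ φ, 0 < φ → φ ≤ Real.pi / 2 →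
      |(HC (j + 1)).1 φ| ≤ (Real.pi / 2) ^ (2 * j + 3) * (((j : ℝ) + 1) ^ 2 * K) := by
  intro φ h0 h1
  have hp := Real.pi_pos
  set F : ℝ → ℝ := fun x => Real.sin x ^ (2 * j + 3) * (HC (j + 1)).1 x with hF
  have hder : ∀ x ∈ Set.Ioo 0 Real.pi,
      HasDerivAt F (-(((j : ℝ) + 1) ^ 2 * Real.sin x ^ (2 * j + 2) * (HC j).1 x)) x := by
    intro x hx
    have hs : Real.sin x ≠ 0 := (Real.sin_pos_of_mem_Ioo hx).ne'
    have := ((Real.hasDerivAt_sin x).pow (2 * j + 3)).mul (HC_deriv (j + 1) x hx).1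
    refine this.congr_deriv ?_
    have e : (HC (j + 1 + 1)).1 x * Real.sin x ^ 2 = (HC (j + 1)).2 x := by
      rw [HC_fst_succ]; field_simp
    rw [HC_snd_succ] at e
    have e2 : 2 * j + 3 - 1 = 2 * j + 2 := by omega
    simp only [Pi.pow_apply, e2]
    push_cast
    linear_combination (-Real.sin x ^ (2 * j + 2)) * e
  have hFb : |F φ| ≤ ((j : ℝ) + 1) ^ 2 * K * φ ^ (2 * j + 3) := by
    refine le_of_forall_pos_le_add fun η hη => ?_
    obtain ⟨ε, hε0, hε1, hε2⟩ : ∃ ε, 0 < ε ∧ ε < φ ∧ K * (Real.sin ε) ≤ η := by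
      refine ⟨min (φ / 2) (η / (K + 1)), by positivity, ?_, ?_⟩
      · exact (min_le_left _ _).trans_lt (by linarith)
      · have a1 : Real.sin (min (φ / 2) (η / (K + 1))) ≤ η / (K + 1) :=
          (Real.sin_le (by positivity)).trans (min_le_right _ _)
        calc _ ≤ K * (η / (K + 1)) := by gcongr
          _ ≤ (K + 1) * (η / (K + 1)) := by gcongr; linarith
          _ = η := by field_simp
    have m := (convex_Icc ε φ).norm_image_sub_le_of_norm_hasDerivWithin_le (f := F)
      (f' := fun x => -(((j : ℝ) + 1) ^ 2 * Real.sin x ^ (2 * j + 2) * (HC j).1 x))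
      (C := ((j : ℝ) + 1) ^ 2 * φ ^ (2 * j + 2) * K) (x := ε) (y := φ)
      (fun x hx => (hder x ⟨by linarith [hx.1], by linarith [hx.2]⟩).hasDerivWithinAt)
      (fun x hx => by
        have hx0 : 0 < x := by linarith [hx.1]
        have hs : 0 < Real.sin x := Real.sin_pos_of_mem_Ioo ⟨hx0, by linarith [hx.2]⟩
        have hsl : Real.sin x ≤ φ := (Real.sin_le hx0.le).trans hx.2
        have hb := (h x hx0 (by linarith [hx.2])).1
        rw [norm_neg, Real.norm_eq_abs, abs_mul,
          abs_of_nonneg (a := ((j : ℝ) + 1) ^ 2 * Real.sin x ^ (2 * j + 2)) (by positivity)]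
        gcongr)
      ⟨le_rfl, hε1.le⟩ ⟨hε1.le, le_rfl⟩
    rw [Real.norm_eq_abs, Real.norm_eq_abs, abs_of_pos (a := φ - ε) (by linarith)] at m
    have hFe : |F ε| ≤ η := by
      have hs : 0 < Real.sin ε := Real.sin_pos_of_mem_Ioo ⟨hε0, by linarith⟩
      have e : F ε = Real.sin ε ^ (2 * j) * Real.sin ε * (HC j).2 ε := by
        simp only [hF, HC_fst_succ]; field_simp; ring
      have hb := (h ε hε0 (by linarith)).2
      have : Real.sin ε ^ (2 * j) ≤ 1 := pow_le_one₀ hs.le (Real.sin_le_one _)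
      rw [e, abs_mul, abs_of_pos (by positivity)]
      calc _ ≤ 1 * Real.sin ε * K := by gcongr
        _ ≤ η := by linarith
    have m2 : ((j : ℝ) + 1) ^ 2 * φ ^ (2 * j + 2) * K * (φ - ε)
        ≤ ((j : ℝ) + 1) ^ 2 * φ ^ (2 * j + 2) * K * φ := by gcongr; linarith
    have m3 : |F φ| ≤ |F φ - F ε| + |F ε| := by
      have := abs_add_le (F φ - F ε) (F ε); simpa using this
    have e : ((j : ℝ) + 1) ^ 2 * φ ^ (2 * j + 2) * K * φ
      = ((j : ℝ) + 1) ^ 2 * K * φ ^ (2 * j + 3) := by ring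
    linarith
  have hs3 := sin_ge_left h0.le h1
  have hpos : 0 < (2 / Real.pi * φ) ^ (2 * j + 3) := by positivity
  have hs : 0 < Real.sin φ := lt_of_lt_of_le (by positivity) hs3
  have k1 : (2 / Real.pi * φ) ^ (2 * j + 3) * |(HC (j + 1)).1 φ| ≤ |F φ| := by
    simp only [hF]
    rw [abs_mul, abs_of_pos (a := Real.sin φ ^ (2 * j + 3)) (by positivity)]
    gcongr
  have k2 : (2 / Real.pi * φ) ^ (2 * j + 3) *
      ((Real.pi / 2) ^ (2 * j + 3) * (((j : ℝ) + 1) ^ 2 * K))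
      = ((j : ℝ) + 1) ^ 2 * K * φ ^ (2 * j + 3) := by
    rw [← mul_assoc, ← mul_pow]
    have : 2 / Real.pi * φ * (Real.pi / 2) = φ := by field_simp
    rw [this]; ring
  refine le_of_mul_le_mul_left ?_ hpos
  rw [k2]
  exact k1.trans hFb

theorem H_bound (j : ℕ) : ∃ K : ℝ, 0 < K ∧ ∀ φ ∈ Set.Ioo 0 Real.pi,
    |(HC j).1 φ| * (Real.pi - φ) ^ (2 * j + 1) ≤ K ∧
    |(HC j).2 φ| * (Real.pi - φ) ^ (2 * j + 1) ≤ K := by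
  have hp := Real.pi_pos
  induction j with
  | zero =>
    refine ⟨Real.pi ^ 2 / 4 + Real.pi, by positivity, fun φ hφ => ?_⟩
    have hb := H0_bounds hφ
    have hs := Real.sin_pos_of_mem_Ioo hφ
    obtain ⟨h0, h1⟩ := hφ
    have hH : 0 < (HC 0).1 φ := by simp only [HC]; positivity
    have e : (HC 0).2 φ = Real.cos φ * (HC 0).1 φ - 1 / 2 := rfl
    have a1 : |(HC 0).2 φ| ≤ (HC 0).1 φ + 1 / 2 := by
      rw [e]
      have c1 := Real.cos_le_one φ
      have c2 := Real.neg_one_le_cos φ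
      rw [abs_le]; constructor <;> nlinarith
    rw [abs_of_pos hH]
    simp only [Nat.mul_zero, Nat.zero_add, pow_one]
    refine ⟨by linarith [hb.2], ?_⟩
    have : |(HC 0).2 φ| * (Real.pi - φ) ≤ ((HC 0).1 φ + 1 / 2) * (Real.pi - φ) := by
      gcongr
    nlinarith [hb.2]
  | succ j ih =>
    obtain ⟨K, hK, h⟩ := ih
    set L := K / (Real.pi / 2) ^ (2 * j + 1) with hL
    have hLp : 0 < L := by positivity
    have near := H_near_zero j L hLp.le (fun φ h0 h1 => by
      have hb := h φ ⟨h0, by linarith⟩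
      have hd : (Real.pi / 2) ^ (2 * j + 1) ≤ (Real.pi - φ) ^ (2 * j + 1) := by
        gcongr; linarith
      rw [hL, le_div_iff₀ (by positivity), le_div_iff₀ (by positivity)]
      exact ⟨(mul_le_mul_of_nonneg_left hd (abs_nonneg _)).trans hb.1,
        (mul_le_mul_of_nonneg_left hd (abs_nonneg _)).trans hb.2⟩)
    set A := (Real.pi / 2) ^ (2 * j + 3) * (((j : ℝ) + 1) ^ 2 * L) with hA
    have hAp : 0 < A := by positivity
    set B := A * Real.pi ^ (2 * j + 3) + K * (Real.pi / 2) ^ 2 with hB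
    have hBp : 0 < B := by positivity
    have key : ∀ φ ∈ Set.Ioo 0 Real.pi,
        |(HC (j + 1)).1 φ| * (Real.pi - φ) ^ (2 * j + 3) ≤ B := by
      intro φ hφ
      have hs := Real.sin_pos_of_mem_Ioo hφ
      have hd : 0 < Real.pi - φ := by linarith [hφ.2]
      rcases le_total φ (Real.pi / 2) with hh | hh
      · have n := near φ hφ.1 hh
        calc _ ≤ A * Real.pi ^ (2 * j + 3) := by gcongr; linarith [hφ.1]
          _ ≤ B := by rw [hB]; linarith [show 0 < K * (Real.pi / 2) ^ 2 by positivity]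
      · have s := sin_ge_right hh hφ.2.le
        have s' : Real.pi - φ ≤ Real.pi / 2 * Real.sin φ := by
          rw [div_mul_eq_mul_div, div_le_iff₀ hp] at s
          linarith
        have hb := (h φ hφ).2
        have q : (Real.pi - φ) ^ 2 / Real.sin φ ^ 2 ≤ (Real.pi / 2) ^ 2 := by
          rw [div_le_iff₀ (by positivity), ← mul_pow]; gcongr
        have e : |(HC (j + 1)).1 φ| * (Real.pi - φ) ^ (2 * j + 3)
            = (|(HC j).2 φ| * (Real.pi - φ) ^ (2 * j + 1)) *
              ((Real.pi - φ) ^ 2 / Real.sin φ ^ 2) := by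
          rw [HC_fst_succ, abs_div, abs_of_pos (a := Real.sin φ ^ 2) (by positivity)]
          ring
        rw [e]
        calc _ ≤ K * (Real.pi / 2) ^ 2 := by gcongr
          _ ≤ B := by rw [hB]; linarith [show 0 < A * Real.pi ^ (2 * j + 3) by positivity]
    refine ⟨(2 * (j : ℝ) + 3) * B + ((j : ℝ) + 1) ^ 2 * (K * Real.pi ^ 2), by positivity,
      fun φ hφ => ?_⟩
    have hd : 0 < Real.pi - φ := by linarith [hφ.2]
    have k := key φ hφ
    have e3 : 2 * (j + 1) + 1 = 2 * j + 3 := by ring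
    rw [e3]
    have p1 : 0 < ((j : ℝ) + 1) ^ 2 * (K * Real.pi ^ 2) := by positivity
    refine ⟨by nlinarith [show (0 : ℝ) ≤ j * B by positivity], ?_⟩
    have a1 : |(HC (j + 1)).2 φ| ≤ (2 * (j : ℝ) + 3) * |(HC (j + 1)).1 φ|
        + ((j : ℝ) + 1) ^ 2 * |(HC j).1 φ| := by
      rw [HC_snd_succ]
      refine (abs_add_le _ _).trans ?_
      rw [abs_mul, abs_mul, abs_mul, abs_of_nonneg (a := 2 * (j : ℝ) + 3) (by positivity),
        abs_of_nonneg (a := ((j : ℝ) + 1) ^ 2) (by positivity)]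
      gcongr
      have := Real.abs_cos_le_one φ
      exact mul_le_of_le_one_right (by positivity) this
    have a2 : |(HC j).1 φ| * (Real.pi - φ) ^ (2 * j + 3) ≤ K * Real.pi ^ 2 := by
      have : |(HC j).1 φ| * (Real.pi - φ) ^ (2 * j + 3)
        = (|(HC j).1 φ| * (Real.pi - φ) ^ (2 * j + 1)) * (Real.pi - φ) ^ 2 := by ring
      rw [this]
      have := (h φ hφ).1
      gcongr
      linarith [hφ.1]
    calc _ ≤ ((2 * (j : ℝ) + 3) * |(HC (j + 1)).1 φ|
        + ((j : ℝ) + 1) ^ 2 * |(HC j).1 φ|) * (Real.pi - φ) ^ (2 * j + 3) := by gcongr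
      _ = (2 * (j : ℝ) + 3) * (|(HC (j + 1)).1 φ| * (Real.pi - φ) ^ (2 * j + 3))
        + ((j : ℝ) + 1) ^ 2 * (|(HC j).1 φ| * (Real.pi - φ) ^ (2 * j + 3)) := by ring
      _ ≤ _ := by gcongr

theorem H_bound_unif (n : ℕ) : ∃ K : ℝ, 0 < K ∧ ∀ j ≤ n, ∀ φ ∈ Set.Ioo 0 Real.pi,
    |(HC j).1 φ| * (Real.pi - φ) ^ (2 * j + 1) ≤ K := by
  choose K hK h using H_bound
  refine ⟨∑ j ∈ Finset.range (n + 1), K j,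
    Finset.sum_pos (fun j _ => hK j) ⟨0, by simp⟩, fun j hj φ hφ => ?_⟩
  exact ((h j φ hφ).1).trans (Finset.single_le_sum (f := K) (fun i _ => (hK i).le)
    (by simp; omega))

theorem W_deriv (t φ : ℝ) (ht : 0 < t) : HasDerivAt (W t) (-(φ / (2 * t)) * W t φ) φ := by
  have h : HasDerivAt (fun x : ℝ => -x ^ 2 / (4 * t)) (-(φ / (2 * t))) φ := by
    have := (((hasDerivAt_id φ).pow 2).neg).div_const (4 * t)
    refine this.congr_deriv ?_
    simp
    field_simp
    ring
  have := (h.exp).const_mul (1 / Real.sqrt (4 * Real.pi * t))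
  refine this.congr_deriv ?_
  simp only [W]; ring

/-- If `negD` applied at a point of differentiability. -/
theorem negD_hasDerivAt {f : ℝ → ℝ} {φ : ℝ} (hφ : φ ∈ Set.Ioo 0 Real.pi)
    (hf : DifferentiableAt ℝ f φ) : HasDerivAt f (-Real.sin φ * negD f φ) φ := by
  have hs : Real.sin φ ≠ 0 := (Real.sin_pos_of_mem_Ioo hφ).ne'
  refine hf.hasDerivAt.congr_deriv ?_
  simp only [negD]; field_simp

theorem negD_eq {f : ℝ → ℝ} {φ a : ℝ} (hφ : φ ∈ Set.Ioo 0 Real.pi)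
    (hf : HasDerivAt f (-Real.sin φ * a) φ) : negD f φ = a := by
  have hs : Real.sin φ ≠ 0 := (Real.sin_pos_of_mem_Ioo hφ).ne'
  simp only [negD, hf.deriv]; field_simp

theorem iter_formula (t : ℝ) (ht : 0 < t) (n : ℕ) :
    (∀ m ≤ n, ∀ φ ∈ Set.Ioo 0 Real.pi, DifferentiableAt ℝ (negD^[m] (W t)) φ) ∧
    (∀ φ ∈ Set.Ioo 0 Real.pi, (negD^[n + 1] (W t)) φ =
      t⁻¹ * ∑ ij ∈ Finset.HasAntidiagonal.antidiagonal n, (n.choose ij.1 : ℝ) *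
        ((HC ij.1).1 φ * (negD^[ij.2] (W t)) φ)) := by
  induction n with
  | zero =>
    refine ⟨fun m hm φ hφ => ?_, fun φ hφ => ?_⟩
    · obtain rfl : m = 0 := by omega
      exact (W_deriv t φ ht).differentiableAt
    · have hs : Real.sin φ ≠ 0 := (Real.sin_pos_of_mem_Ioo hφ).ne'
      simp only [zero_add, Function.iterate_one]
      refine negD_eq hφ ((W_deriv t φ ht).congr_deriv ?_)
      simp [HC]
      field_simp
  | succ n ih =>
    obtain ⟨ih1, ih2⟩ := ih
    have hder : ∀ φ ∈ Set.Ioo 0 Real.pi, HasDerivAt (negD^[n + 1] (W t))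
        (-Real.sin φ * (t⁻¹ * ∑ ij ∈ Finset.HasAntidiagonal.antidiagonal (n + 1), ((n + 1).choose ij.1 : ℝ) *
        ((HC ij.1).1 φ * (negD^[ij.2] (W t)) φ))) φ := by
      intro φ hφ
      have h1 : HasDerivAt (fun φ => t⁻¹ * ∑ ij ∈ Finset.HasAntidiagonal.antidiagonal n, (n.choose ij.1 : ℝ) *
        ((HC ij.1).1 φ * (negD^[ij.2] (W t)) φ))
          (t⁻¹ * ∑ ij ∈ Finset.HasAntidiagonal.antidiagonal n, (n.choose ij.1 : ℝ) *
            ((-Real.sin φ * (HC (ij.1 + 1)).1 φ) * (negD^[ij.2] (W t)) φ +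
              (HC ij.1).1 φ * (-Real.sin φ * (negD^[ij.2 + 1] (W t)) φ))) φ := by
        refine HasDerivAt.const_mul _ (HasDerivAt.fun_sum fun ij hij => ?_)
        refine HasDerivAt.const_mul _ ?_
        have hle : ij.2 ≤ n := by
          have := Finset.HasAntidiagonal.mem_antidiagonal.1 hij; omega
        have hy := negD_hasDerivAt hφ (ih1 ij.2 hle φ hφ)
        rw [← Function.iterate_succ_apply' negD ij.2 (W t)] at hy
        exact (HC_deriv ij.1 φ hφ).1.mul hy
      have h2 : (negD^[n + 1] (W t)) =ᶠ[nhds φ] (fun φ => t⁻¹ *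
          ∑ ij ∈ Finset.HasAntidiagonal.antidiagonal n, (n.choose ij.1 : ℝ) *
        ((HC ij.1).1 φ * (negD^[ij.2] (W t)) φ)) := by
        filter_upwards [isOpen_Ioo.mem_nhds hφ] with x hx using ih2 x hx
      refine (h1.congr_of_eventuallyEq h2).congr_deriv ?_
      rw [Finset.sum_antidiagonal_choose_succ_mul
        (fun i j => (HC i).1 φ * (negD^[j] (W t)) φ) n]
      rw [mul_left_comm (-Real.sin φ), ← Finset.sum_add_distrib,
        Finset.mul_sum _ _ (-Real.sin φ)]
      congr 1
      refine Finset.sum_congr rfl fun ij hij => ?_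
      have : n.choose ij.2 = n.choose ij.1 := by
        have := Finset.HasAntidiagonal.mem_antidiagonal.1 hij
        rw [← this]; exact (Nat.choose_symm_add).symm
      rw [this]; ring
    refine ⟨fun m hm φ hφ => ?_, fun φ hφ => ?_⟩
    · rcases Nat.lt_or_ge m (n + 1) with h | h
      · exact ih1 m (by omega) φ hφ
      · obtain rfl : m = n + 1 := by omega
        exact (hder φ hφ).differentiableAt
    · rw [Function.iterate_succ_apply']
      exact negD_eq hφ (hder φ hφ)

theorem W_pos (t φ : ℝ) (ht : 0 < t) : 0 < W t φ := by
  have := Real.pi_pos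
  unfold W; positivity

theorem main_bound (n : ℕ) : ∃ M c C : ℝ, 1 ≤ M ∧ 0 < c ∧ 0 < C ∧ ∀ m ≤ n,
    ∀ φ t : ℝ, φ ∈ Set.Ioo 0 Real.pi → 0 < t → M ≤ (Real.pi - φ) / t →
      c * W t φ * (t⁻¹ / (Real.pi - φ)) ^ m ≤ (negD^[m] (W t)) φ ∧
      (negD^[m] (W t)) φ ≤ C * W t φ * (t⁻¹ / (Real.pi - φ)) ^ m := by
  have hp := Real.pi_pos
  induction n with
  | zero =>
    refine ⟨1, 1, 1, le_rfl, one_pos, one_pos, fun m hm φ t hφ ht hM => ?_⟩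
    obtain rfl : m = 0 := by omega
    simp
  | succ n ih =>
    obtain ⟨M, c, C, hM1, hc, hC, h⟩ := ih
    obtain ⟨K, hK, hH⟩ := H_bound_unif n
    set E := (n : ℝ) * (2 ^ n * K * C) with hE
    have hE0 : 0 ≤ E := by positivity
    set d := c * (Real.pi / 8) with hd
    have hdp : 0 < d := by positivity
    refine ⟨max M (E / d), min c d, max C (C * (Real.pi ^ 2 / 4) + d), hM1.trans (le_max_left _ _),
      by positivity, by positivity, fun m hm φ t hφ ht hM => ?_⟩
    have hW := W_pos t φ ht
    have hδ : 0 < Real.pi - φ := by linarith [hφ.2]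
    have hMM := (le_max_left _ _).trans hM
    have hMd := (le_max_right _ _).trans hM
    set δ := Real.pi - φ with hδd
    set r := t⁻¹ / δ with hr
    have hrp : 0 < r := by positivity
    rcases Nat.lt_or_ge m (n + 1) with hmn | hmn
    · obtain ⟨a, b⟩ := h m (by omega) φ t hφ ht hMM
      refine ⟨le_trans ?_ a, b.trans ?_⟩
      · gcongr; exact min_le_left _ _
      · gcongr; exact le_max_left _ _
    obtain rfl : m = n + 1 := by omega
    have hf := (iter_formula t ht n).2 φ hφ
    rw [Finset.Nat.sum_antidiagonal_eq_sum_range_succ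
      (fun i j => (n.choose i : ℝ) * ((HC i).1 φ * (negD^[j] (W t)) φ)),
      Finset.sum_range_succ', mul_add] at hf
    simp only [Nat.choose_zero_right, Nat.cast_one, one_mul, Nat.sub_zero] at hf
    set R := t⁻¹ * ∑ k ∈ Finset.range n, (n.choose (k + 1) : ℝ) *
      ((HC (k + 1)).1 φ * (negD^[n - (k + 1)] (W t)) φ) with hR
    obtain ⟨y1, y2⟩ := h n le_rfl φ t hφ ht hMM
    obtain ⟨g1, g2⟩ := H0_bounds hφ
    rw [← hδd] at g1 g2
    set q := δ / t with hq
    have hqp : 0 < q := by positivity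
    have hq1 : 1 ≤ q := hM1.trans hMM
    have hrR : |R| ≤ d * W t φ * r ^ (n + 1) := by
      have term : ∀ k ∈ Finset.range n, |(n.choose (k + 1) : ℝ) *
          ((HC (k + 1)).1 φ * (negD^[n - (k + 1)] (W t)) φ)|
          ≤ 2 ^ n * K * C * (W t φ * (r ^ n / δ) / q) := by
        intro k hk
        have hk' : k + 1 ≤ n := by have := Finset.mem_range.1 hk; omega
        obtain ⟨z1, z2⟩ := h (n - (k + 1)) (by omega) φ t hφ ht hMM
        have z0 : 0 ≤ (negD^[n - (k + 1)] (W t)) φ := le_trans (by positivity) z1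
        have hb := hH (k + 1) hk' φ hφ
        rw [← hδd, ← le_div_iff₀ (by positivity)] at hb
        have hch : (n.choose (k + 1) : ℝ) ≤ 2 ^ n := by
          exact_mod_cast Nat.choose_le_two_pow n (k + 1)
        rw [abs_mul, abs_mul, abs_of_nonneg z0, Nat.abs_cast]
        have hqk : q ≤ q ^ (k + 1) := le_self_pow₀ hq1 (by omega)
        have e : K / δ ^ (2 * (k + 1) + 1) * (C * W t φ * r ^ (n - (k + 1)))
            = K * C * (W t φ * (r ^ n / δ) / q ^ (k + 1)) := by
          have : r ^ n = r ^ (n - (k + 1)) * r ^ (k + 1) := by rw [← pow_add]; congr 1; omega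
          rw [this]
          have : r ^ (k + 1) = q ^ (k + 1) / δ ^ (2 * (k + 1)) := by
            rw [pow_mul, ← div_pow]; congr 1; rw [hr, hq]; field_simp
          rw [this]; field_simp; ring
        calc _ ≤ 2 ^ n * (K / δ ^ (2 * (k + 1) + 1) * (C * W t φ * r ^ (n - (k + 1)))) := by
              gcongr
          _ = 2 ^ n * K * C * (W t φ * (r ^ n / δ) / q ^ (k + 1)) := by rw [e]; ring
          _ ≤ _ := by gcongr
      have hsum := (Finset.abs_sum_le_sum_abs _ _).trans (Finset.sum_le_sum term)
      rw [Finset.sum_const, Finset.card_range, nsmul_eq_mul] at hsum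
      rw [hR, abs_mul, abs_of_pos (a := t⁻¹) (by positivity)]
      have hEq : E / q ≤ d := by
        rw [div_le_iff₀ hdp] at hMd
        rw [div_le_iff₀ hqp]; linarith
      calc _ ≤ t⁻¹ * (n * (2 ^ n * K * C * (W t φ * (r ^ n / δ) / q))) := by gcongr
        _ = (E / q) * W t φ * (r ^ n * (t⁻¹ / δ)) := by rw [hE]; ring
        _ = (E / q) * W t φ * r ^ (n + 1) := by rw [← hr]; ring
        _ ≤ _ := by gcongr
    have hmain : t⁻¹ * ((HC 0).1 φ * (negD^[n] (W t)) φ)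
        = r * (((HC 0).1 φ * δ) * (negD^[n] (W t)) φ) := by
      rw [hr]; field_simp
    have y0 : 0 ≤ (negD^[n] (W t)) φ := le_trans (by positivity) y1
    have g0 : 0 ≤ (HC 0).1 φ * δ := le_trans (by positivity) g1
    have lo : r * ((Real.pi / 4) * (c * W t φ * r ^ n)) ≤
        t⁻¹ * ((HC 0).1 φ * (negD^[n] (W t)) φ) := by
      rw [hmain]; gcongr
    have hi : t⁻¹ * ((HC 0).1 φ * (negD^[n] (W t)) φ) ≤
        r * ((Real.pi ^ 2 / 4) * (C * W t φ * r ^ n)) := by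
      rw [hmain]; gcongr
    obtain ⟨r1, r2⟩ := abs_le.1 hrR
    rw [hf]
    constructor
    · calc _ ≤ d * W t φ * r ^ (n + 1) := by gcongr; exact min_le_right _ _
        _ = r * ((Real.pi / 4) * (c * W t φ * r ^ n)) - d * W t φ * r ^ (n + 1) := by
            rw [hd]; ring
        _ ≤ _ := by linarith
    · calc _ ≤ r * ((Real.pi ^ 2 / 4) * (C * W t φ * r ^ n)) + d * W t φ * r ^ (n + 1) := by
            linarith
        _ = (C * (Real.pi ^ 2 / 4) + d) * W t φ * r ^ (n + 1) := by ring
        _ ≤ _ := by gcongr; exact le_max_right _ _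

/-- Sharp estimate for `((-D)^N W_t)(φ)` in the regime `(π-φ)/t ≥ M₀`
(Lemma 4.4 of the paper), valid for all `t > 0`. -/
theorem negD_iter_gauss_kernel_sharp_estimate (N : ℕ) :
    ∃ M₀ : ℝ, 0 < M₀ ∧ ∃ c C : ℝ, 0 < c ∧ 0 < C ∧
      ∀ φ t : ℝ, φ ∈ Set.Ioo 0 Real.pi → 0 < t → M₀ ≤ (Real.pi - φ) / t →
        c * W t φ * (Real.pi - φ) ^ (-(N : ℝ)) * t ^ (-(N : ℝ)) ≤
          (negD^[N] (W t)) φ ∧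
        (negD^[N] (W t)) φ ≤
          C * W t φ * (Real.pi - φ) ^ (-(N : ℝ)) * t ^ (-(N : ℝ)) := by
  obtain ⟨M, c, C, hM, hc, hC, h⟩ := main_bound N
  refine ⟨M, by linarith, c, C, hc, hC, fun φ t hφ ht hMt => ?_⟩
  have hδ : 0 < Real.pi - φ := by linarith [hφ.2]
  have e : ∀ a : ℝ, a * W t φ * (Real.pi - φ) ^ (-(N : ℝ)) * t ^ (-(N : ℝ))
      = a * W t φ * (t⁻¹ / (Real.pi - φ)) ^ N := by
    intro a
    rw [Real.rpow_neg hδ.le, Real.rpow_neg ht.le, Real.rpow_natCast, Real.rpow_natCast,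
      div_pow, inv_pow]
    ring
  rw [e, e]
  exact h N le_rfl φ t hφ ht hMt
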